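/- arXiv:2211.15369 — 2 statements merged into one kernel-verified Lean document; each statement's English description precedes it below -/
import Mathlib

section
/- Let N be a positive integer, let k be a positive divisor of N, and let γ = (a b; Nc d) ∈ Γ₀(N) with c > 0. Then for all τ in the upper half-plane, η(k·((aτ + b)/(Ncτ + d))) = ε(a, kb, Nc/k, d)·(−i(Ncτ + d))^{1/2}·η(kτ), where ε(a,b,c,d) = exp[πi((a + d)/(12c) + s(−d, c))] and the square root is the principal branch. -/
open Complex

/-- The Dedekind eta function `η(τ) = e^{πiτ/12} ∏_{n ≥ 1} (1 − e^{2πinτ})`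
(the formula defining it on the upper half-plane, where the product converges). -/
noncomputable def dedekindEta (τ : ℂ) : ℂ :=
  Complex.exp (Real.pi * Complex.I * τ / 12) *
    ∏' n : ℕ, (1 - Complex.exp (2 * Real.pi * Complex.I * (n + 1) * τ))

/-- The Dedekind sum `s(a,b) = ∑_{ℓ=1}^{b−1} (ℓ/b)(aℓ/b − ⌊aℓ/b⌋ − 1/2)`. -/
def dedekindSum (a b : ℤ) : ℚ :=
  ∑ ℓ ∈ Finset.Ico 1 b.toNat,
    ((ℓ : ℚ) / b) * ((a * ℓ : ℚ) / b - ⌊(a * ℓ : ℚ) / b⌋ - 1 / 2)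

/-- The multiplier `ε(a,b,c,d) = exp[πi((a+d)/(12c) + s(−d,c))]` in the eta transformation law. -/
noncomputable def dedekindEps (a b c d : ℤ) : ℂ :=
  Complex.exp (Real.pi * Complex.I * (((a : ℂ) + d) / (12 * c) + (dedekindSum (-d) c : ℂ)))

theorem sum_range_mul_mod {c d : ℕ} (h : d.Coprime c) {M : Type*} [AddCommMonoid M] (f : ℕ → M) :
    ∑ l ∈ Finset.range c, f (d * l % c) = ∑ l ∈ Finset.range c, f l := by
  have hmaps : Set.MapsTo (fun l ↦ d * l % c) (Finset.range c) (Finset.range c) := by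
    intro l hl
    simp only [Finset.coe_range, Set.mem_Iio] at hl ⊢
    exact Nat.mod_lt _ (by omega)
  have hinj : Set.InjOn (fun l ↦ d * l % c) (Finset.range c) := by
    intro x hx y hy hxy
    simp only [Finset.coe_range, Set.mem_Iio] at hx hy
    exact Nat.ModEq.eq_of_lt_of_lt (Nat.ModEq.cancel_left_of_coprime h.symm hxy) hx hy
  exact Finset.sum_nbij _ hmaps hinj
    (Finset.surjOn_of_injOn_of_card_le _ hmaps hinj le_rfl) fun _ _ ↦ rfl

theorem sum_range_cast_id (n : ℕ) :
    ∑ l ∈ Finset.range n, (l : ℚ) = n * (n - 1) / 2 := by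
  induction n with
  | zero => simp
  | succ n ih => rw [Finset.sum_range_succ, ih]; push_cast; ring

theorem sum_range_cast_sq (n : ℕ) :
    ∑ l ∈ Finset.range n, (l : ℚ) ^ 2 = n * (n - 1) * (2 * n - 1) / 6 := by
  induction n with
  | zero => simp
  | succ n ih => rw [Finset.sum_range_succ, ih]; push_cast; ring

theorem dedekindSum_natCast (d c : ℕ) :
    dedekindSum d c = ∑ l ∈ Finset.range c,
      (l : ℚ) / c * ((d * l : ℚ) / c - ((d * l / c : ℕ) : ℚ) - 1 / 2) := by
  rcases Nat.eq_zero_or_pos c with rfl | hc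
  · simp [dedekindSum]
  rw [Finset.range_eq_Ico, Finset.sum_eq_sum_Ico_succ_bot hc, dedekindSum]
  simp only [Int.toNat_natCast, Int.cast_natCast, Nat.cast_zero, zero_div, zero_mul, zero_add]
  refine Finset.sum_congr rfl fun l _ ↦ ?_
  have : ⌊(d * l : ℚ) / c⌋ = ((d * l / c : ℕ) : ℤ) := by
    have := Rat.floor_intCast_div_natCast (d * l : ℤ) c
    push_cast at this ⊢
    exact this
  rw [this, Int.cast_natCast]

/-- The sum `∑ ⌊dℓ/c⌋(⌊dℓ/c⌋ + 1)` evaluated by counting lattice points under the diagonal. -/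
theorem sum_div_mul_div_add_one {c d : ℕ} (hc : 0 < c) (hd : 0 < d) (h : d.Coprime c) :
    ∑ l ∈ Finset.range c, (((d * l / c : ℕ) : ℚ) * ((d * l / c : ℕ) + 1)) =
      2 * ∑ m ∈ Finset.range d, (m : ℚ) * (c - 1 - ((c * m / d : ℕ) : ℚ)) := by
  have hleft : ∀ l ∈ Finset.range c, (((d * l / c : ℕ) : ℚ) * ((d * l / c : ℕ) + 1)) =
      2 * ∑ m ∈ Finset.range d, if m * c ≤ d * l then (m : ℚ) else 0 := by
    intro l hl
    have hlt : d * l / c < d := by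
      rw [Nat.div_lt_iff_lt_mul hc]
      exact Nat.mul_lt_mul_of_pos_left (Finset.mem_range.mp hl) hd
    rw [← Finset.sum_filter]
    have : (Finset.range d).filter (fun m ↦ m * c ≤ d * l) = Finset.range (d * l / c + 1) := by
      ext m
      rw [Finset.mem_filter, Finset.mem_range, Finset.mem_range, ← Nat.le_div_iff_mul_le hc]
      omega
    rw [this, sum_range_cast_id]
    push_cast
    ring
  have hright : ∀ m ∈ Finset.range d, (m : ℚ) * (c - 1 - ((c * m / d : ℕ) : ℚ)) =
      ∑ l ∈ Finset.range c, if m * c ≤ d * l then (m : ℚ) else 0 := by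
    intro m hm
    rcases Nat.eq_zero_or_pos m with rfl | hm0
    · simp
    have hmd := Finset.mem_range.mp hm
    have hlt : c * m / d < c := by
      rw [Nat.div_lt_iff_lt_mul hd]
      exact Nat.mul_lt_mul_of_pos_left hmd hc
    rw [← Finset.sum_filter]
    have : (Finset.range c).filter (fun l ↦ m * c ≤ d * l) = Finset.Ico (c * m / d + 1) c := by
      ext l
      have hne : m * c ≠ d * l := fun he ↦ by
        have : d ∣ m := h.dvd_of_dvd_mul_right ⟨l, he⟩
        exact absurd (Nat.le_of_dvd hm0 this) (by omega)
      rw [Finset.mem_filter, Finset.mem_range, Finset.mem_Ico, Nat.succ_le_iff,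
        Nat.div_lt_iff_lt_mul hd, mul_comm c m, mul_comm l d]
      omega
    rw [this, Finset.sum_const, Nat.card_Ico, nsmul_eq_mul, Nat.cast_sub hlt]
    push_cast
    ring
  rw [Finset.sum_congr rfl hleft, Finset.sum_congr rfl hright, ← Finset.mul_sum, Finset.sum_comm]

/-- Dedekind's reciprocity law. -/
theorem dedekindSum_reciprocity {c d : ℕ} (hc : 0 < c) (hd : 0 < d) (h : d.Coprime c) :
    dedekindSum c d + dedekindSum d c =
      ((c : ℚ) ^ 2 + d ^ 2 + 1) / (12 * c * d) - 1 / 4 := by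
  have hc' : (c : ℚ) ≠ 0 := by positivity
  have hd' : (d : ℚ) ≠ 0 := by positivity
  have hmod : ∀ l : ℕ, ((d * l % c : ℕ) : ℚ) = d * l - c * (d * l / c : ℕ) := fun l ↦ by
    rw [eq_sub_iff_add_eq]
    exact_mod_cast Nat.mod_add_div (d * l) c
  have h1 := sum_range_mul_mod h (fun l ↦ (l : ℚ))
  have h2 := sum_range_mul_mod h (fun l ↦ (l : ℚ) ^ 2)
  have h3 := sum_div_mul_div_add_one hc hd h
  simp only [hmod] at h1 h2
  have e1 : dedekindSum d c = d / c ^ 2 * ∑ l ∈ Finset.range c, (l : ℚ) ^ 2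
      - 1 / c * ∑ l ∈ Finset.range c, (l : ℚ) * ((d * l / c : ℕ) : ℚ)
      - 1 / (2 * c) * ∑ l ∈ Finset.range c, (l : ℚ) := by
    rw [dedekindSum_natCast, Finset.mul_sum, Finset.mul_sum, Finset.mul_sum,
      ← Finset.sum_sub_distrib, ← Finset.sum_sub_distrib]
    exact Finset.sum_congr rfl fun l _ ↦ by field_simp
  have e2 : dedekindSum c d = c / d ^ 2 * ∑ m ∈ Finset.range d, (m : ℚ) ^ 2
      - 1 / d * ∑ m ∈ Finset.range d, (m : ℚ) * ((c * m / d : ℕ) : ℚ)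
      - 1 / (2 * d) * ∑ m ∈ Finset.range d, (m : ℚ) := by
    rw [dedekindSum_natCast, Finset.mul_sum, Finset.mul_sum, Finset.mul_sum,
      ← Finset.sum_sub_distrib, ← Finset.sum_sub_distrib]
    exact Finset.sum_congr rfl fun l _ ↦ by field_simp
  have e3 : ∑ l ∈ Finset.range c, ((d : ℚ) * l - c * (d * l / c : ℕ)) ^ 2 =
      d ^ 2 * ∑ l ∈ Finset.range c, (l : ℚ) ^ 2
      - 2 * d * c * ∑ l ∈ Finset.range c, (l : ℚ) * ((d * l / c : ℕ) : ℚ)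
      + c ^ 2 * ∑ l ∈ Finset.range c, ((d * l / c : ℕ) : ℚ) ^ 2 := by
    rw [Finset.mul_sum, Finset.mul_sum, Finset.mul_sum,
      ← Finset.sum_sub_distrib, ← Finset.sum_add_distrib]
    exact Finset.sum_congr rfl fun l _ ↦ by ring
  have e4 : ∑ l ∈ Finset.range c, (((d * l / c : ℕ) : ℚ) * ((d * l / c : ℕ) + 1)) =
      ∑ l ∈ Finset.range c, ((d * l / c : ℕ) : ℚ) ^ 2
      + ∑ l ∈ Finset.range c, ((d * l / c : ℕ) : ℚ) := by
    rw [← Finset.sum_add_distrib]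
    exact Finset.sum_congr rfl fun l _ ↦ by ring
  have e5 : ∑ m ∈ Finset.range d, (m : ℚ) * (c - 1 - ((c * m / d : ℕ) : ℚ)) =
      (c - 1) * ∑ m ∈ Finset.range d, (m : ℚ)
      - ∑ m ∈ Finset.range d, (m : ℚ) * ((c * m / d : ℕ) : ℚ) := by
    rw [Finset.mul_sum, ← Finset.sum_sub_distrib]
    exact Finset.sum_congr rfl fun l _ ↦ by ring
  rw [Finset.sum_sub_distrib, ← Finset.mul_sum, ← Finset.mul_sum] at h1
  rw [e3] at h2
  rw [e4, e5] at h3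
  rw [e1, e2]
  simp only [sum_range_cast_id, sum_range_cast_sq] at *
  generalize ∑ l ∈ Finset.range c, (l : ℚ) * ((d * l / c : ℕ) : ℚ) = A at *
  generalize ∑ m ∈ Finset.range d, (m : ℚ) * ((c * m / d : ℕ) : ℚ) = B at *
  generalize ∑ l ∈ Finset.range c, ((d * l / c : ℕ) : ℚ) = Q at *
  generalize ∑ l ∈ Finset.range c, ((d * l / c : ℕ) : ℚ) ^ 2 = R at *
  have hQ : Q = (d - 1) * (c - 1) / 2 := by
    apply mul_left_cancel₀ hc'
    linear_combination -h1
  have hB : B = (c - 1) * (d * (d - 1) / 2) - (R + Q) / 2 := by linear_combination h3 / 2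
  have hA : A = ((d ^ 2 - 1) * (c * (c - 1) * (2 * c - 1) / 6) + c ^ 2 * R) / (2 * d * c) := by
    rw [eq_div_iff (by positivity)]
    linear_combination -h2
  rw [hA, hB, hQ]
  field_simp
  ring

theorem dedekindSum_add_mul (a n b : ℤ) : dedekindSum (a + n * b) b = dedekindSum a b := by
  refine Finset.sum_congr rfl fun l hl ↦ ?_
  have hb : (b : ℚ) ≠ 0 := by
    have := Finset.mem_Ico.mp hl
    exact_mod_cast (by omega : b ≠ 0)
  have : (((a + n * b : ℤ) : ℚ) * l) / b = (a * l : ℚ) / b + ((n * l : ℤ) : ℚ) := by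
    push_cast
    field_simp
  rw [this, Int.floor_add_intCast]
  push_cast
  ring

theorem dedekindSum_neg {a b : ℤ} (h : IsCoprime a b) : dedekindSum (-a) b = -dedekindSum a b := by
  rw [dedekindSum, dedekindSum, ← Finset.sum_neg_distrib]
  refine Finset.sum_congr rfl fun l hl ↦ ?_
  obtain ⟨h1, h2⟩ := Finset.mem_Ico.mp hl
  have hb : (b : ℚ) ≠ 0 := by exact_mod_cast (by omega : b ≠ 0)
  have hfrac : Int.fract ((a * l : ℚ) / b) ≠ 0 := by
    rw [Ne, Int.fract_eq_zero_iff]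
    rintro ⟨m, hm⟩
    rw [eq_div_iff hb] at hm
    have hm' : m * b = a * l := by exact_mod_cast hm
    have : b ≤ l := Int.le_of_dvd (by omega) (h.symm.dvd_of_dvd_mul_left ⟨m, by rw [← hm', mul_comm]⟩)
    omega
  have key := Int.fract_neg hfrac
  rw [Int.fract, Int.fract] at key
  rw [show ((-a : ℤ) * l : ℚ) / b = -((a * l : ℚ) / b) by push_cast; ring]
  linear_combination (l : ℚ) / b * key

theorem dedekindEta_eq_eta (τ : ℂ) : dedekindEta τ = ModularForm.eta τ := by
  simp only [dedekindEta, ModularForm.eta, ModularForm.eta_q_eq_cexp, Function.Periodic.qParam]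
  congr 2
  push_cast
  ring

theorem dedekindEta_add_intCast (τ : ℂ) (n : ℤ) :
    dedekindEta (τ + n) = cexp (Real.pi * I * n / 12) * dedekindEta τ := by
  have hterm : ∀ m : ℕ, cexp (2 * Real.pi * I * (m + 1) * (τ + n)) =
      cexp (2 * Real.pi * I * (m + 1) * τ) := fun m ↦ by
    rw [← exp_periodic.int_mul ((m + 1) * n) (2 * Real.pi * I * (m + 1) * τ)]
    congr 1
    push_cast
    ring
  simp only [dedekindEta, hterm, ← mul_assoc, ← Complex.exp_add]
  congr 2
  ring

theorem neg_I_mul_cpow_half {z : ℂ} (hz : 0 < z.im) :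
    (-I * z) ^ ((1 : ℂ) / 2) = cexp (-(Real.pi * I / 4)) * z ^ ((1 : ℂ) / 2) := by
  have hz0 : z ≠ 0 := by rintro rfl; simp at hz
  have h0 : 0 ≤ z.arg := arg_nonneg_iff.mpr hz.le
  have hpi := arg_le_pi z
  have hlog : log (-I * z) = log (-I) + log z := by
    refine Complex.log_mul (neg_ne_zero.mpr I_ne_zero) hz0 ?_
    rw [arg_neg_I]
    constructor <;> linarith [Real.pi_pos]
  rw [cpow_def_of_ne_zero (mul_ne_zero (neg_ne_zero.mpr I_ne_zero) hz0),
    cpow_def_of_ne_zero hz0, hlog, log_neg_I, ← Complex.exp_add]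
  congr 1
  ring

theorem cpow_mul_cpow_of_re_pos {u v : ℂ} (hu : 0 < u.re) (hv : 0 < v.re) (s : ℂ) :
    u ^ s * v ^ s = (u * v) ^ s := by
  have hu0 : u ≠ 0 := by rintro rfl; simp at hu
  have hv0 : v ≠ 0 := by rintro rfl; simp at hv
  have h1 := abs_lt.mp (abs_arg_lt_pi_div_two_iff.mpr (.inl hu))
  have h2 := abs_lt.mp (abs_arg_lt_pi_div_two_iff.mpr (.inl hv))
  rw [cpow_def_of_ne_zero hu0, cpow_def_of_ne_zero hv0, cpow_def_of_ne_zero (mul_ne_zero hu0 hv0),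
    Complex.log_mul hu0 hv0 ⟨by linarith, by linarith⟩, ← Complex.exp_add, add_mul]

theorem dedekindEta_neg_one_div {τ : ℂ} (hτ : 0 < τ.im) :
    dedekindEta (-1 / τ) = (-I * τ) ^ ((1 : ℂ) / 2) * dedekindEta τ := by
  have h := ModularForm.eta_comp_eq_csqrt_I_inv hτ
  simp only [Function.comp_apply, Pi.smul_apply, Pi.mul_apply, smul_eq_mul] at h
  rw [dedekindEta_eq_eta, dedekindEta_eq_eta, h, neg_I_mul_cpow_half hτ, ← mul_assoc,
    sqrt_eq_exp I_ne_zero, log_I, ← Complex.exp_neg, sqrt]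
  congr 2
  · congr 1
    ring
  · norm_num

/-- The transformation law of the eta function under a matrix of `SL(2, ℤ)` with positive
lower left entry. -/
theorem dedekindEta_transform {c : ℕ} (hc : 0 < c) {a b d : ℤ} (hdet : a * d - b * c = 1)
    {τ : ℂ} (hτ : 0 < τ.im) :
    dedekindEta ((a * τ + b) / (c * τ + d)) =
      dedekindEps a b c d * (-I * (c * τ + d)) ^ ((1 : ℂ) / 2) * dedekindEta τ := by
  induction c using Nat.strong_induction_on generalizing a b d τ with
  | _ c ih =>
  have hcC : (c : ℂ) ≠ 0 := by exact_mod_cast hc.ne'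
  -- translating `τ` reduces to the case where `d` is its residue modulo `c`
  suffices H : ∀ (b : ℤ) (e : ℕ) (τ : ℂ), e < c → a * e - b * c = 1 → 0 < τ.im →
      dedekindEta ((a * τ + b) / (c * τ + e)) =
        dedekindEps a b c e * (-I * (c * τ + e)) ^ ((1 : ℂ) / 2) * dedekindEta τ by
    obtain ⟨e, he⟩ := Int.eq_ofNat_of_zero_le (Int.emod_nonneg d (by omega : (c : ℤ) ≠ 0))
    have hlt : e < c := by
      have := Int.emod_lt_of_pos d (by omega : (0 : ℤ) < c)
      omega
    set n := d / (c : ℤ) with hn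
    have hd : d = e + n * c := by
      have := Int.emod_add_mul_ediv d c
      rw [he] at this
      linear_combination -this
    have h := H (b - n * a) e (τ + n) hlt (by rw [hd] at hdet; linear_combination hdet)
      (by simpa using hτ)
    have h1 : (a : ℂ) * (τ + n) + (b - n * a : ℤ) = a * τ + b := by push_cast; ring
    have h2 : (c : ℂ) * (τ + n) + e = c * τ + d := by rw [hd]; push_cast; ring
    have hs : dedekindSum (-d) c = dedekindSum (-e) c := by
      rw [← dedekindSum_add_mul (-e) (-n) c, hd]
      congr 1
      ring
    rw [h1, h2, dedekindEta_add_intCast] at h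
    rw [h, dedekindEps, dedekindEps, hs, hd]
    have : cexp (Real.pi * I * (((a : ℂ) + (e + n * c : ℤ)) / (12 * (c : ℤ)) +
        (dedekindSum (-e) c : ℂ))) = cexp (Real.pi * I * (((a : ℂ) + (e : ℤ)) / (12 * (c : ℤ)) +
        (dedekindSum (-e) c : ℂ))) * cexp (Real.pi * I * n / 12) := by
      rw [← Complex.exp_add]
      congr 1
      push_cast
      field_simp
      ring
    rw [this]
    ring
  clear hdet hτ
  intro b e τ hlt hdet hτ
  have hτ0 : τ ≠ 0 := by rintro rfl; simp at hτ
  have him : 0 < (-1 / τ).im := by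
    rw [neg_div, one_div, neg_im, inv_im, neg_div, neg_neg]
    exact div_pos hτ (normSq_pos.mpr hτ0)
  rcases Nat.eq_zero_or_pos e with rfl | he
  · have hbc : (-b) * (c : ℤ) = 1 := by linear_combination hdet
    have hc1 : c = 1 := by
      have : (c : ℤ) = 1 := Int.eq_one_of_dvd_one (by omega) (Dvd.intro_left _ hbc)
      exact_mod_cast this
    subst hc1
    obtain rfl : b = -1 := by push_cast at hbc; omega
    have h1 : ((a : ℂ) * τ + (-1 : ℤ)) / ((1 : ℕ) * τ + (0 : ℕ)) = -1 / τ + a := by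
      simp only [Nat.cast_one, Nat.cast_zero, one_mul, add_zero]
      push_cast
      field_simp
      ring
    rw [h1, dedekindEta_add_intCast, dedekindEta_neg_one_div hτ, ← mul_assoc]
    congr 2
    · simp only [dedekindEps, dedekindSum]
      congr 1
      simp
      ring
    · simp
  · have hcop : IsCoprime (e : ℤ) c := ⟨a, -b, by linear_combination hdet⟩
    have h := ih e hlt he (a := b) (b := -a) (d := -c) (by linear_combination hdet) him
    have hden : (c : ℂ) * τ + e ≠ 0 := fun h0 ↦ by
      have := congrArg Complex.im h0
      simp [hc.ne', hτ.ne'] at this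
    have h1 : ((b : ℂ) * (-1 / τ) + (-a : ℤ)) / (e * (-1 / τ) + (-c : ℤ)) =
        (a * τ + b) / (c * τ + e) := by
      have : (e : ℂ) * (-1 / τ) + (-c : ℤ) = -(c * τ + e) / τ := by
        push_cast
        field_simp
        ring
      rw [this, div_eq_div_iff (div_ne_zero (neg_ne_zero.mpr hden) hτ0) hden]
      push_cast
      field_simp
      ring
    have hsqrt : (-I * (e * (-1 / τ) + (-c : ℤ))) ^ ((1 : ℂ) / 2) * (-I * τ) ^ ((1 : ℂ) / 2) =
        cexp (Real.pi * I / 4) * (-I * (c * τ + e)) ^ ((1 : ℂ) / 2) := by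
      rw [cpow_mul_cpow_of_re_pos, neg_I_mul_cpow_half, ← mul_assoc (cexp _), ← Complex.exp_add,
        add_neg_cancel, Complex.exp_zero, one_mul]
      · congr 1
        push_cast
        field_simp
        linear_combination (-(c * τ) - e) * I_sq
      · simpa [hc] using hτ
      · have : (-I * ((e : ℂ) * (-1 / τ) + (-c : ℤ))).re = e * (-1 / τ).im := by simp
        rw [this]
        positivity
      · simpa using hτ
    have hrec := dedekindSum_reciprocity hc he (Nat.isCoprime_iff_coprime.mp hcop)
    rw [h1, dedekindEta_neg_one_div hτ, mul_assoc, ← mul_assoc (_ ^ _), hsqrt] at h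
    rw [h, ← mul_assoc, ← mul_assoc, dedekindEps, dedekindEps, ← Complex.exp_add,
      dedekindSum_neg hcop, neg_neg, eq_sub_of_add_eq hrec]
    congr 3
    have heC : (e : ℂ) ≠ 0 := by exact_mod_cast he.ne'
    have hdetC : (a : ℂ) * e - b * c = 1 := by exact_mod_cast hdet
    push_cast
    field_simp
    linear_combination -4 * hdetC

/-- **Eta transformation under `Γ₀(N)` with a scaling `k ∣ N`.**
Let `N` be a positive integer, `k` a positive divisor of `N`, and
`γ = (a b; Nc d) ∈ Γ₀(N)` with `c > 0` (membership in `SL(2, ℤ)`, and hence in `Γ₀(N)`,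
being recorded by the determinant condition `ad − b(Nc) = 1`). Then for all `τ` in the
upper half-plane,
`η(k·(aτ+b)/(Ncτ+d)) = ε(a, kb, Nc/k, d) · (−i(Ncτ+d))^{1/2} · η(kτ)`,
with the principal branch of the square root. -/
theorem dedekindEta_transform_Gamma0 (N : ℕ) (hN : 0 < N) (k : ℕ) (hk : 0 < k)
    (hkN : k ∣ N) (a b c d : ℤ) (hc : 0 < c) (hdet : a * d - b * ((N : ℤ) * c) = 1)
    (τ : ℂ) (hτ : 0 < τ.im) :
    dedekindEta ((k : ℂ) * (((a : ℂ) * τ + b) / ((N : ℂ) * c * τ + d))) =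
      dedekindEps a ((k : ℤ) * b) ((N : ℤ) * c / k) d *
        (-Complex.I * ((N : ℂ) * c * τ + d)) ^ ((1 : ℂ) / 2) *
        dedekindEta ((k : ℂ) * τ) := by
  obtain ⟨m, rfl⟩ := hkN
  obtain ⟨c, rfl⟩ := Int.eq_ofNat_of_zero_le hc.le
  have hm : 0 < m := Nat.pos_of_mul_pos_left hN
  have hkτ : 0 < ((k : ℂ) * τ).im := by
    simpa [hk] using hτ
  have hquot : ((k * m : ℕ) : ℤ) * (c : ℤ) / k = (m * c : ℕ) := by
    push_cast
    rw [mul_assoc, Int.mul_ediv_cancel_left _ (by omega)]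
  have h := dedekindEta_transform (c := m * c) (Nat.mul_pos hm (by omega)) (a := a) (b := k * b)
    (d := d) (by push_cast at hdet ⊢; linear_combination hdet) hkτ
  rw [hquot]
  convert h using 2
  · push_cast
    ring
  · push_cast
    ring_nf
end

section
/- For every positive integer N, the number ν₃(Γ₀(N)) of Γ₀(N)-inequivalent elliptic points of order 3 equals ∏_{p|N}(1 + (−3/p)) if 9 ∤ N, and equals 0 if 9 | N; here the product runs over the distinct prime divisors p of N and (−3/p) = +1 if p ≡ 1 (mod 3), −1 if p ≡ 2 (mod 3), and 0 if p = 3. -/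
open Matrix CongruenceSubgroup UpperHalfPlane
open scoped MatrixGroups

/-- The natural homomorphism `SL(2, ℤ) →* PSL(2, ℝ)`, obtained by composing the inclusion
`SL(2, ℤ) → SL(2, ℝ)` with the quotient by the centre (`PSL(2, ℝ) = SL(2, ℝ)/{±I}`). -/
noncomputable def toPSL : SL(2, ℤ) →* (SL(2, ℝ) ⧸ Subgroup.center SL(2, ℝ)) :=
  (QuotientGroup.mk' (Subgroup.center SL(2, ℝ))).comp
    (Matrix.SpecialLinearGroup.map (Int.castRingHom ℝ))

/-- A point `z ∈ ℍ` is an elliptic point of order `n` for a subgroup `Γ'` of `SL(2, ℤ)` if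
the stabiliser of `z` in the image of `Γ'` in `PSL(2, ℝ)` — equivalently, the image in
`PSL(2, ℝ)` of the stabiliser `Γ' ⊓ Stab(z)` (since `−I` acts trivially on `ℍ`) — is a
cyclic group of order `n`. -/
def IsEllipticPointOfOrder (Γ' : Subgroup SL(2, ℤ)) (n : ℕ) (z : ℍ) : Prop :=
  IsCyclic (Subgroup.map toPSL (Γ' ⊓ MulAction.stabilizer SL(2, ℤ) z)) ∧
  Nat.card (Subgroup.map toPSL (Γ' ⊓ MulAction.stabilizer SL(2, ℤ) z)) = n

/-- `ν_n(Γ')`: the number of `Γ'`-orbits of elliptic points of order `n` in `ℍ`. -/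
noncomputable def numEllipticOrbits (Γ' : Subgroup SL(2, ℤ)) (n : ℕ) : ℕ :=
  Nat.card {O : Set ℍ // ∃ z : ℍ, IsEllipticPointOfOrder Γ' n z ∧
    O = {w : ℍ | ∃ γ ∈ Γ', γ • z = w}}

/-- The symbol `(−3/p)`: it is `+1` if `p ≡ 1 (mod 3)`, `−1` if `p ≡ 2 (mod 3)`, and `0`
if `p = 3` (more generally, if `3 ∣ p`). -/
def legendreNegThree (p : ℕ) : ℤ :=
  if p % 3 = 1 then 1 else if p % 3 = 2 then -1 else 0

open ModularGroup

section PSL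

theorem toPSL_eq_one_iff {g : SL(2, ℤ)} :
    toPSL g = 1 ↔ Matrix.SpecialLinearGroup.map (Int.castRingHom ℝ) g ∈
      Subgroup.center SL(2, ℝ) := by
  simp [toPSL]

theorem toPSL_neg (g : SL(2, ℤ)) : toPSL (-g) = toPSL g := by
  have h : toPSL (-1) = 1 := by
    rw [toPSL_eq_one_iff, Subgroup.mem_center_iff]
    intro A
    have : Matrix.SpecialLinearGroup.map (Int.castRingHom ℝ) (-1 : SL(2, ℤ)) = -1 := by
      ext i j
      simp [Matrix.one_apply]
    rw [this]
    simp
  rw [← neg_one_mul, map_mul, h, one_mul]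

theorem toPSL_S_mul_T_ne_one : toPSL (S * T) ≠ 1 := by
  rw [Ne, toPSL_eq_one_iff, Matrix.SpecialLinearGroup.mem_center_iff]
  rintro ⟨r, -, hr⟩
  have := congrFun (congrFun hr 1) 0
  simp [coe_S, coe_T, Matrix.mul_apply, Fin.sum_univ_two] at this

theorem S_mul_T_pow_three : (S * T) ^ 3 = -1 := by decide

theorem S_mul_T_sq : (S * T) ^ 2 = T⁻¹ * S := by decide

end PSL

section Stabilizer

theorem S_mul_T_smul_ρ : (S * T) • ρ = ρ := by
  rw [stabilizer_ρ]
  simp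

theorem toPSL_eq_pow_of_smul_ρ {g : SL(2, ℤ)} (h : g • ρ = ρ) :
    ∃ k : ℕ, toPSL g = toPSL (S * T) ^ k := by
  rw [stabilizer_ρ] at h
  simp only [Finset.mem_insert, Finset.mem_singleton] at h
  rcases h with rfl | rfl | rfl | rfl | rfl | rfl
  · exact ⟨0, by simp⟩
  · exact ⟨0, by rw [toPSL_neg]; simp⟩
  · exact ⟨1, by simp⟩
  · exact ⟨1, by rw [toPSL_neg]; simp⟩
  · exact ⟨2, by rw [← map_pow, S_mul_T_sq]⟩
  · exact ⟨2, by rw [toPSL_neg, ← map_pow, S_mul_T_sq]⟩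

theorem orderOf_toPSL_conj (g : SL(2, ℤ)) : orderOf (toPSL (g * (S * T) * g⁻¹)) = 3 := by
  refine orderOf_eq_prime ?_ ?_
  · rw [← map_pow, conj_pow, S_mul_T_pow_three]
    simp only [mul_neg, mul_one, neg_mul, mul_inv_cancel, toPSL_neg, map_one]
  · rw [map_mul, map_mul, map_inv, Ne, conj_eq_one_iff]
    exact toPSL_S_mul_T_ne_one

theorem isEllipticPointOfOrder_three_of_conj_mem {Γ : Subgroup SL(2, ℤ)} {g : SL(2, ℤ)}
    (h : g * (S * T) * g⁻¹ ∈ Γ) : IsEllipticPointOfOrder Γ 3 (g • ρ) := by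
  have key : Subgroup.map toPSL (Γ ⊓ MulAction.stabilizer SL(2, ℤ) (g • ρ)) =
      Subgroup.zpowers (toPSL (g * (S * T) * g⁻¹)) := by
    apply le_antisymm
    · rintro _ ⟨δ, ⟨-, hδ⟩, rfl⟩
      have hδ' : (g⁻¹ * δ * g) • ρ = ρ := by
        rw [mul_smul, mul_smul, MulAction.mem_stabilizer_iff.1 hδ, inv_smul_smul]
      obtain ⟨k, hk⟩ := toPSL_eq_pow_of_smul_ρ hδ'
      refine ⟨k, ?_⟩
      have hconj : δ = g * (g⁻¹ * δ * g) * g⁻¹ := by group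
      simp only [zpow_natCast]
      rw [hconj]
      simp only [map_mul toPSL g, map_mul toPSL _ g⁻¹, hk, map_inv, conj_pow]
    · rw [Subgroup.zpowers_le]
      refine ⟨_, ⟨h, ?_⟩, rfl⟩
      change (g * (S * T) * g⁻¹) • (g • ρ) = g • ρ
      rw [mul_smul, inv_smul_smul, mul_smul,
        S_mul_T_smul_ρ]
  unfold IsEllipticPointOfOrder
  rw [key]
  exact ⟨inferInstance, by rw [Nat.card_zpowers, orderOf_toPSL_conj]⟩

/-- A point whose stabilizer contains an element of order three in `PSL(2, ℝ)` lies in the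
orbit of `ρ`. -/
theorem exists_eq_smul_ρ {z : ℍ} {δ : SL(2, ℤ)} (hz : δ • z = z)
    (h1 : toPSL δ ≠ 1) (h3 : toPSL δ ^ 3 = 1) : ∃ g : SL(2, ℤ), z = g • ρ := by
  obtain ⟨g, hg⟩ := exists_smul_mem_fd z
  have hfix : (g * δ * g⁻¹) • (g • z) = g • z := by
    rw [mul_smul, inv_smul_smul, mul_smul, hz]
  have h1' : toPSL (g * δ * g⁻¹) ≠ 1 := by
    rwa [map_mul, map_mul, map_inv, Ne, conj_eq_one_iff]
  have h3' : toPSL (g * δ * g⁻¹) ^ 3 = 1 := by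
    rw [map_mul, map_mul, map_inv, conj_pow, h3, mul_one, mul_inv_cancel]
  by_cases hρ : g • z = ρ
  · exact ⟨g⁻¹, by rw [← hρ, inv_smul_smul]⟩
  by_cases hρ' : g • z = (1 : ℝ) +ᵥ ρ
  · exact ⟨g⁻¹ * T, by rw [mul_smul, modular_T_smul, ← hρ', inv_smul_smul]⟩
  exfalso
  by_cases hI : g • z = I
  · rw [hI, stabilizer_I] at hfix
    have hS : (S : SL(2, ℤ)) ^ 2 = -1 := by decide
    have h2 : toPSL (g * δ * g⁻¹) ^ 2 = 1 := by
      rw [← map_pow]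
      simp only [Finset.mem_insert, Finset.mem_singleton] at hfix
      rcases hfix with h | h | h | h <;> rw [h] <;> simp [hS, toPSL_neg]
    rw [pow_succ, h2, one_mul] at h3'
    exact h1' h3'
  · rcases stabilizer_of_ne hg hfix hI hρ hρ' with h | h <;>
      exact h1' (by rw [h]; simp [toPSL_neg])

theorem isEllipticPointOfOrder_three_iff {Γ : Subgroup SL(2, ℤ)} (hΓ : -1 ∈ Γ) {z : ℍ} :
    IsEllipticPointOfOrder Γ 3 z ↔ ∃ g : SL(2, ℤ), z = g • ρ ∧ g * (S * T) * g⁻¹ ∈ Γ := by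
  refine ⟨fun ⟨_, hcard⟩ ↦ ?_, ?_⟩
  · have : Finite (Subgroup.map toPSL (Γ ⊓ MulAction.stabilizer SL(2, ℤ) z)) :=
      Nat.finite_of_card_ne_zero (by rw [hcard]; norm_num)
    have : Fact (Nat.Prime 3) := ⟨Nat.prime_three⟩
    obtain ⟨⟨_, δ, ⟨hδΓ, hδz⟩, rfl⟩, hx⟩ := exists_prime_orderOf_dvd_card' 3 hcard.symm.dvd
    replace hx : orderOf (toPSL δ) = 3 := by
      rw [← hx, ← Subgroup.orderOf_coe]
    have h3 : toPSL δ ^ 3 = 1 := hx ▸ pow_orderOf_eq_one _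
    have h1 : toPSL δ ≠ 1 := by
      intro h
      rw [h, orderOf_one] at hx
      norm_num at hx
    replace hδz : δ • z = z := hδz
    obtain ⟨g, rfl⟩ := exists_eq_smul_ρ hδz h1 h3
    refine ⟨g, rfl, ?_⟩
    have hfix : (g⁻¹ * δ * g) • ρ = ρ := by
      rw [mul_smul, mul_smul, hδz, inv_smul_smul]
    have h1' : toPSL (g⁻¹ * δ * g) ≠ 1 := by
      intro h
      rw [map_mul, map_mul, map_inv] at h
      apply h1
      rw [← conj_eq_one_iff (a := (toPSL g)⁻¹), inv_inv, h]
    have hδ : δ = g * (g⁻¹ * δ * g) * g⁻¹ := by group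
    have hneg {x : SL(2, ℤ)} (hx : x ∈ Γ) : -x ∈ Γ := by
      simpa using Γ.mul_mem hΓ hx
    rw [stabilizer_ρ] at hfix
    simp only [Finset.mem_insert, Finset.mem_singleton] at hfix
    have hinv : T⁻¹ * S = -(S * T)⁻¹ := by decide
    rcases hfix with h | h | h | h | h | h
    · exact absurd (by rw [h, map_one]) h1'
    · exact absurd (by rw [h, toPSL_neg, map_one]) h1'
    · rwa [← h, ← hδ]
    · have := hneg hδΓ
      rw [hδ, h] at this
      simpa [-sl_moeb] using this
    · have := Γ.inv_mem (hneg hδΓ)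
      rw [hδ, h, hinv] at this
      simpa [mul_assoc] using this
    · have := Γ.inv_mem hδΓ
      rw [hδ, h, hinv] at this
      simpa [mul_assoc] using this
  · rintro ⟨g, rfl, hg⟩
    exact isEllipticPointOfOrder_three_of_conj_mem hg

end Stabilizer

section Orbits

theorem neg_one_mem_Gamma0 (N : ℕ) : -1 ∈ Gamma0 N := by
  simp [Gamma0_mem]

theorem SL2_det_intCast (N : ℕ) (g : SL(2, ℤ)) :
    (g 0 0 : ZMod N) * g 1 1 - g 0 1 * g 1 0 = 1 := by
  have := g.det_coe
  rw [Matrix.det_fin_two] at this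
  exact_mod_cast congrArg (Int.cast : ℤ → ZMod N) this

theorem conj_mem_Gamma0_iff {N : ℕ} {g : SL(2, ℤ)} :
    g * (S * T) * g⁻¹ ∈ Gamma0 N ↔
      (g 1 0 : ZMod N) ^ 2 - g 1 0 * g 1 1 + g 1 1 ^ 2 = 0 := by
  have : (g * (S * T) * g⁻¹) 1 0 = g 1 0 ^ 2 - g 1 0 * g 1 1 + g 1 1 ^ 2 := by
    simp [Matrix.mul_apply, Fin.sum_univ_two, coe_S, coe_T, Matrix.adjugate_fin_two]
    ring
  rw [Gamma0_mem, this]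
  push_cast
  rfl

theorem mul_inv_mem_Gamma0_iff {N : ℕ} {g h : SL(2, ℤ)} :
    g * h⁻¹ ∈ Gamma0 N ↔ (g 1 0 * h 1 1 : ZMod N) = g 1 1 * h 1 0 := by
  have : (g * h⁻¹) 1 0 = g 1 0 * h 1 1 - g 1 1 * h 1 0 := by
    simp [Matrix.mul_apply, Fin.sum_univ_two, Matrix.adjugate_fin_two]
    ring
  rw [Gamma0_mem, this]
  push_cast
  rw [sub_eq_zero]

theorem S_mul_T_zpow_row (n : ℤ) : (S * T ^ n) 1 0 = 1 ∧ (S * T ^ n) 1 1 = n := by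
  simp [coe_S, coe_T_zpow, Matrix.mul_apply, Fin.sum_univ_two]

/-- The ratio of the bottom row of `g` is unchanged modulo `N` when `g` is multiplied on the right
by an element of the stabilizer of `ρ`. -/
theorem eq_of_smul_ρ_eq {N : ℕ} {x y : ZMod N} {g h : SL(2, ℤ)}
    (hy : y ^ 2 - y + 1 = 0) (hg : (g 1 1 : ZMod N) = x * g 1 0) (hh : (h 1 1 : ZMod N) = y * h 1 0)
    (hgh : g • ρ = h • ρ) : x = y := by
  have hfix : (h⁻¹ * g) • ρ = ρ := by rw [mul_smul, hgh, inv_smul_smul]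
  obtain ⟨k, hk⟩ : ∃ k, h⁻¹ * g = k := ⟨_, rfl⟩
  obtain rfl : g = h * k := by rw [← hk]; group
  rw [hk, stabilizer_ρ] at hfix
  have hk' : k 0 1 = - k 1 0 ∧ k 1 1 = k 0 0 + k 1 0 := by
    simp only [Finset.mem_insert, Finset.mem_singleton] at hfix
    rcases hfix with rfl | rfl | rfl | rfl | rfl | rfl <;> decide
  have e0 : (h * k) 1 0 = h 1 0 * k 0 0 + h 1 1 * k 1 0 := by
    simp [Matrix.mul_apply, Fin.sum_univ_two]
  have e1 : (h * k) 1 1 = h 1 0 * k 0 1 + h 1 1 * k 1 1 := by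
    simp [Matrix.mul_apply, Fin.sum_univ_two]
  have hdet := SL2_det_intCast N (h * k)
  rw [e0, e1, hk'.1, hk'.2] at hg
  rw [e0, e1, hk'.1, hk'.2] at hdet
  push_cast at hg hdet
  rw [hh] at hg hdet
  have hxy : (x - y) * (h 1 0 * k 0 0 + y * h 1 0 * k 1 0) = 0 := by
    linear_combination -(h 1 0 * k 1 0 : ZMod N) * hy - hg
  linear_combination (((h * k) 0 0 : ℤ) * x - ((h * k) 0 1 : ℤ) : ZMod N) * hxy - (x - y) * hdet +
    (x - y) * (((h * k) 0 0 : ℤ) : ZMod N) * hg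

/-- The `Γ₀(N)`-orbits of elliptic points of order three correspond to the roots of `x² - x + 1`
modulo `N`. -/
theorem numEllipticOrbits_Gamma0_three (N : ℕ) :
    numEllipticOrbits (Gamma0 N) 3 = Nat.card {x : ZMod N // x ^ 2 - x + 1 = 0} := by
  symm
  let g : ZMod N → SL(2, ℤ) := fun x ↦ S * T ^ (x.cast : ℤ)
  have g0 (x) : ((g x 1 0 : ℤ) : ZMod N) = 1 := by rw [(S_mul_T_zpow_row _).1]; simp
  have g1 (x) : ((g x 1 1 : ℤ) : ZMod N) = x := by rw [(S_mul_T_zpow_row _).2]; simp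
  have hell (x : {x : ZMod N // x ^ 2 - x + 1 = 0}) :
      IsEllipticPointOfOrder (Gamma0 N) 3 (g x • ρ) := by
    apply isEllipticPointOfOrder_three_of_conj_mem
    rw [conj_mem_Gamma0_iff, g0, g1]
    linear_combination x.2
  refine Nat.card_congr (Equiv.ofBijective (fun x ↦ ⟨{w | ∃ γ ∈ Gamma0 N, γ • (g x • ρ) = w},
    g x • ρ, hell x, rfl⟩) ⟨?_, ?_⟩)
  · intro x y hxy
    have hmem : g y • ρ ∈ {w | ∃ γ ∈ Gamma0 N, γ • (g x • ρ) = w} := by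
      rw [show {w | ∃ γ ∈ Gamma0 N, γ • (g x • ρ) = w} = _ from congrArg Subtype.val hxy]
      exact ⟨1, one_mem _, one_smul _ _⟩
    obtain ⟨γ, hγ, h⟩ := hmem
    rw [← mul_smul] at h
    refine Subtype.ext (eq_of_smul_ρ_eq y.2 ?_ ?_ h)
    · have e0 : (γ * g x) 1 0 = γ 1 0 * g x 0 0 + γ 1 1 * g x 1 0 := by
        simp [Matrix.mul_apply, Fin.sum_univ_two]
      have e1 : (γ * g x) 1 1 = γ 1 0 * g x 0 1 + γ 1 1 * g x 1 1 := by
        simp [Matrix.mul_apply, Fin.sum_univ_two]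
      rw [Gamma0_mem] at hγ
      rw [e0, e1]
      push_cast
      rw [hγ, g0, g1]
      ring
    · rw [g0, g1, mul_one]
  · rintro ⟨_, z, hz, rfl⟩
    obtain ⟨h, rfl, hh⟩ := (isEllipticPointOfOrder_three_iff (neg_one_mem_Gamma0 N)).1 hz
    rw [conj_mem_Gamma0_iff] at hh
    have hdet := SL2_det_intCast N h
    set a : ZMod N := ((h 0 0 : ℤ) : ZMod N)
    set b : ZMod N := ((h 0 1 : ℤ) : ZMod N)
    set c : ZMod N := ((h 1 0 : ℤ) : ZMod N) with hc
    set d : ZMod N := ((h 1 1 : ℤ) : ZMod N) with hd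
    set x : ZMod N := a * d - b * d - a * c with hx
    have hxc : x * c = d := by linear_combination d * hdet - a * hh
    have hxd : x * d = d - c := by linear_combination (d - c) * hdet - b * hh
    have hroot : x ^ 2 - x + 1 = 0 := by
      have hc0 : c * (x ^ 2 - x + 1) = 0 := by linear_combination x * hxc + hxd - hxc
      have hd0 : d * (x ^ 2 - x + 1) = 0 := by linear_combination x * hxd - hxc
      linear_combination a * hd0 - b * hc0 - (x ^ 2 - x + 1) * hdet
    have hδ : h * (g x)⁻¹ ∈ Gamma0 N := by
      rw [mul_inv_mem_Gamma0_iff, g0, g1, ← hc, ← hd]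
      linear_combination hxc
    refine ⟨⟨x, hroot⟩, Subtype.ext ?_⟩
    have hrw : h • ρ = (h * (g x)⁻¹) • (g x • ρ) := by rw [mul_smul, inv_smul_smul]
    ext w
    simp only [Set.mem_ofPred_eq]
    constructor
    · rintro ⟨γ, hγ, rfl⟩
      refine ⟨γ * (h * (g x)⁻¹)⁻¹, mul_mem hγ (inv_mem hδ), ?_⟩
      rw [hrw, mul_smul, inv_smul_smul]
    · rintro ⟨γ, hγ, rfl⟩
      exact ⟨γ * (h * (g x)⁻¹), mul_mem hγ hδ, by rw [hrw, mul_smul]⟩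

end Orbits

section Roots

/-- The number of roots of `x² - x + 1` modulo `N`. -/
noncomputable def numRoots (N : ℕ) : ℕ := Nat.card {x : ZMod N // x ^ 2 - x + 1 = 0}

theorem numRoots_mul {m n : ℕ} (h : m.Coprime n) : numRoots (m * n) = numRoots m * numRoots n := by
  unfold numRoots
  rw [← Nat.card_prod]
  refine Nat.card_congr (((ZMod.chineseRemainder h).toEquiv.subtypeEquiv
    (q := fun z ↦ z.1 ^ 2 - z.1 + 1 = 0 ∧ z.2 ^ 2 - z.2 + 1 = 0) fun x ↦ ?_).trans
    (Equiv.subtypeProdEquivProd (p := fun x : ZMod m ↦ x ^ 2 - x + 1 = 0)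
      (q := fun x : ZMod n ↦ x ^ 2 - x + 1 = 0)))
  rw [← (ZMod.chineseRemainder h).map_eq_zero_iff]
  simp [Prod.ext_iff]

theorem numRoots_eq_zero_of_dvd {m n : ℕ} (h : m ∣ n) (hm : numRoots m = 0) [NeZero m] :
    numRoots n = 0 := by
  unfold numRoots at *
  rw [Finite.card_eq_zero_iff] at hm
  have : IsEmpty {x : ZMod n // x ^ 2 - x + 1 = 0} := by
    refine ⟨fun x ↦ hm.elim ⟨ZMod.castHom h (ZMod m) x, ?_⟩⟩
    rw [← map_pow, ← map_sub, ← map_one (ZMod.castHom h (ZMod m)), ← map_add, x.2, map_zero]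
  exact Nat.card_of_isEmpty

theorem numRoots_nine : numRoots 9 = 0 := by
  unfold numRoots
  rw [Nat.card_eq_fintype_card]
  decide

theorem numRoots_three : numRoots 3 = 1 := by
  unfold numRoots
  rw [Nat.card_eq_fintype_card]
  decide

theorem numRoots_eq_zero_of_mod_three_eq_two {p : ℕ} (hp : p.Prime) (h : p % 3 = 2) :
    numRoots p = 0 := by
  have : Fact p.Prime := ⟨hp⟩
  have : IsEmpty {x : ZMod p // x ^ 2 - x + 1 = 0} := by
    refine ⟨fun ⟨x, hx⟩ ↦ ?_⟩
    have h3 : x ^ 3 = -1 := by linear_combination (x + 1) * hx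
    have hx1 : x ^ p = x := ZMod.pow_card x
    have hp2 : x ^ p = x ^ (3 * (p / 3) + 2) := by
      congr 1
      omega
    rw [hp2, pow_add, pow_mul, h3] at hx1
    have h30 : (3 : ZMod p) = 0 := by
      rcases neg_one_pow_eq_or (ZMod p) (p / 3) with e | e <;> rw [e] at hx1
      · linear_combination 3 * hx - 3 * hx1
      · linear_combination 4 * hx - (1 - 2 * x) * (hx + hx1)
    have : p ∣ 3 := by
      rw [← ZMod.natCast_eq_zero_iff]
      exact_mod_cast h30
    rw [Nat.prime_dvd_prime_iff_eq hp Nat.prime_three] at this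
    omega
  exact Nat.card_of_isEmpty

theorem ZMod.isLocalRing_prime_pow {p k : ℕ} (hp : p.Prime) (hk : 0 < k) :
    IsLocalRing (ZMod (p ^ k)) := by
  have : Fact (1 < p ^ k) := ⟨Nat.one_lt_pow hk.ne' hp.one_lt⟩
  refine .of_nonunits_add fun a b ha hb ↦ ?_
  rw [mem_nonunits_iff] at *
  obtain ⟨a, rfl⟩ := ZMod.natCast_zmod_surjective a
  obtain ⟨b, rfl⟩ := ZMod.natCast_zmod_surjective b
  rw [← Nat.cast_add]
  rw [ZMod.isUnit_natCast_iff_not_dvd_pow hp hk, not_not] at *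
  exact dvd_add ha hb

theorem numRoots_prime_pow_of_mod_three_eq_one {p k : ℕ} (hp : p.Prime) (hk : 0 < k)
    (h : p % 3 = 1) : numRoots (p ^ k) = 2 := by
  have := ZMod.isLocalRing_prime_pow hp hk
  have : NeZero (p ^ k) := ⟨(pow_pos hp.pos k).ne'⟩
  have : Fact (Nat.Prime 3) := ⟨Nat.prime_three⟩
  have h3 : IsUnit (3 : ZMod (p ^ k)) := by
    have := (ZMod.isUnit_natCast_iff_not_dvd_pow (a := 3) hp hk).2 fun h' ↦ by
      rw [Nat.prime_dvd_prime_iff_eq hp Nat.prime_three] at h'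
      omega
    exact_mod_cast this
  obtain ⟨r, hr⟩ : ∃ r : ZMod (p ^ k), r ^ 2 - r + 1 = 0 := by
    obtain ⟨u, hu⟩ := exists_prime_orderOf_dvd_card (G := (ZMod (p ^ k))ˣ) 3 (by
      rw [ZMod.card_units_eq_totient, Nat.totient_prime_pow hp hk]
      exact Dvd.dvd.mul_left (by omega) _)
    have hu3 : (u : ZMod (p ^ k)) ^ 3 = 1 := by
      rw [← Units.val_pow_eq_pow_val, ← hu, pow_orderOf_eq_one, Units.val_one]
    have hmul : ((u : ZMod (p ^ k)) - 1) * ((-u : ZMod (p ^ k)) ^ 2 - (-u) + 1) = 0 := by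
      linear_combination hu3
    rcases IsLocalRing.isUnit_or_isUnit_of_isUnit_add (a := ((-u : ZMod (p ^ k)) ^ 2 - (-u) + 1))
      (b := ((u : ZMod (p ^ k)) - 1) * (-(u + 2))) (by convert h3 using 1; ring) with h' | h'
    · rw [h'.mul_left_eq_zero, sub_eq_zero, Units.val_eq_one] at hmul
      rw [hmul, orderOf_one] at hu
      norm_num at hu
    · exact ⟨-u, (isUnit_of_mul_isUnit_left h').mul_right_eq_zero.1 hmul⟩
  have hne : IsUnit (2 * r - 1) := by
    refine isUnit_of_mul_isUnit_left (y := 1 - 2 * r) ?_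
    convert h3 using 1
    linear_combination (-4) * hr
  have hroots : {x : ZMod (p ^ k) | x ^ 2 - x + 1 = 0} = {r, 1 - r} := by
    ext x
    simp only [Set.mem_ofPred_eq, Set.mem_insert_iff, Set.mem_singleton_iff]
    refine ⟨fun hx ↦ ?_, ?_⟩
    · have hmul : (x - r) * (x - (1 - r)) = 0 := by linear_combination hx - hr
      rcases IsLocalRing.isUnit_or_isUnit_of_isUnit_add (a := x - (1 - r)) (b := -(x - r))
        (by convert hne using 1; ring) with h' | h'
      · exact .inl (sub_eq_zero.1 (h'.mul_left_eq_zero.1 hmul))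
      · exact .inr (sub_eq_zero.1 ((IsUnit.neg_iff _).1 h' |>.mul_right_eq_zero.1 hmul))
    · rintro (rfl | rfl) <;> linear_combination hr
  change Nat.card {x : ZMod (p ^ k) | x ^ 2 - x + 1 = 0} = 2
  rw [hroots, Nat.card_coe_set_eq, Set.ncard_pair]
  intro e
  apply hne.ne_zero
  linear_combination e

theorem numRoots_eq {N : ℕ} (hN : 0 < N) (h9 : ¬ 9 ∣ N) :
    (numRoots N : ℤ) = ∏ p ∈ N.primeFactors, (1 + legendreNegThree p) := by
  induction N using Nat.recOnPosPrimePosCoprime with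
  | prime_pow p k hp hk =>
    rw [Nat.primeFactors_prime_pow hk.ne' hp, Finset.prod_singleton]
    have : NeZero p := ⟨hp.ne_zero⟩
    rcases (by omega : p % 3 = 0 ∨ p % 3 = 1 ∨ p % 3 = 2) with h | h | h
    · obtain rfl : p = 3 := ((Nat.prime_dvd_prime_iff_eq Nat.prime_three hp).1
        (Nat.dvd_of_mod_eq_zero h)).symm
      obtain rfl : k = 1 := by
        by_contra hk1
        exact h9 (pow_dvd_pow 3 (show 2 ≤ k by omega))
      rw [pow_one, numRoots_three]
      simp [legendreNegThree]
    · rw [numRoots_prime_pow_of_mod_three_eq_one hp hk h]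
      simp [legendreNegThree, h]
    · rw [numRoots_eq_zero_of_dvd (dvd_pow_self p hk.ne')
        (numRoots_eq_zero_of_mod_three_eq_two hp h)]
      simp [legendreNegThree, h]
  | zero => exact absurd hN (lt_irrefl 0)
  | one =>
    have : numRoots 1 = 1 := by
      unfold numRoots
      rw [Nat.card_eq_fintype_card]
      decide
    simp [this]
  | coprime a b ha hb hab iha ihb =>
    rw [numRoots_mul hab, hab.primeFactors_mul, Finset.prod_union hab.disjoint_primeFactors,
      Nat.cast_mul, iha (by omega) fun h ↦ h9 (h.mul_right b),
      ihb (by omega) fun h ↦ h9 (h.mul_left a)]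

end Roots

/-- **Number of elliptic points of order 3 for `Γ₀(N)`.**
For every positive integer `N`, the number `ν₃(Γ₀(N))` of `Γ₀(N)`-inequivalent elliptic
points of order `3` equals `∏_{p ∣ N} (1 + (−3/p))` if `9 ∤ N`, and equals `0` if `9 ∣ N`;
the product runs over the distinct prime divisors of `N`. -/
theorem nu3_Gamma0 (N : ℕ) (hN : 0 < N) :
    (numEllipticOrbits (Gamma0 N) 3 : ℤ) =
      if 9 ∣ N then 0 else ∏ p ∈ N.primeFactors, (1 + legendreNegThree p) := by
  rw [numEllipticOrbits_Gamma0_three]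
  split_ifs with h9
  · exact_mod_cast numRoots_eq_zero_of_dvd h9 numRoots_nine
  · exact numRoots_eq hN h9
end
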